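/- arXiv:2301.13070 — 4 statements merged into one kernel-verified Lean document; each statement's English description precedes it below -/
import Mathlib

section
/- Let χ̂_s(z) = T (∫_{σ(H)} 2(E₀−λ)/((E₀−λ)²−z²) dP^H_λ) T* with H self-adjoint on ⋀^N L²(ℝ³) satisfying the standing assumptions and T ∈ B(⋀^N L²(ℝ³), 𝓗), and let ω₁ be the smallest pole of χ̂_s in (0,Ω) where Ω = inf σ_ess(H) − E₀. Then for every z = ω + iη ∈ D_Ω \ ((−Ω,−ω₁] ∪ [ω₁,Ω)) and every f ∈ 𝓗, Re⟨f, χ̂_s(z) f⟩ ≤ max{0, (ω²−η²−ω₁²)/|ωη|} · |Im⟨f, χ̂_s(z) f⟩|. -/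
open MeasureTheory ENNReal NNReal Complex Asymptotics
open scoped InnerProductSpace Topology
noncomputable section

/-! ### Meromorphic families of operators (Definition 2.7) -/

section Merom

variable {E F : Type*} [NormedAddCommGroup E] [NormedSpace ℂ E]
  [NormedAddCommGroup F] [NormedSpace ℂ F]

/-- A finite-rank (bounded) operator. -/
def FiniteRankOp (A : E →L[ℂ] F) : Prop := FiniteDimensional ℂ ↥(LinearMap.range (A : E →ₗ[ℂ] F))

/-- `K` is a meromorphic family of operators near `z₀`: near `z₀` it equals a holomorphic
family plus finitely many finite-rank principal parts `K₋ⱼ/(z−z₀)ʲ`. -/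
def MeromAt (K : ℂ → (E →L[ℂ] F)) (z₀ : ℂ) : Prop :=
  ∃ (k : ℕ) (c : ℕ → (E →L[ℂ] F)) (K₀ : ℂ → (E →L[ℂ] F)) (U : Set ℂ),
    IsOpen U ∧ z₀ ∈ U ∧ AnalyticOnNhd ℂ K₀ U ∧ (∀ j, FiniteRankOp (c j)) ∧
    ∀ z ∈ U, z ≠ z₀ → K z = K₀ z + ∑ j ∈ Finset.range k, ((z - z₀) ^ (j + 1))⁻¹ • c j

/-- `K` is a meromorphic family of operators on the open set `D`. -/
def MeromOn (K : ℂ → (E →L[ℂ] F)) (D : Set ℂ) : Prop := ∀ z₀ ∈ D, MeromAt K z₀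

/-- `K` has a simple pole at `z₀` with (finite-rank, nonzero) residue `R`. -/
def SimplePoleAt (K : ℂ → (E →L[ℂ] F)) (z₀ : ℂ) (R : E →L[ℂ] F) : Prop :=
  R ≠ 0 ∧ FiniteRankOp R ∧
  ∃ (K₀ : ℂ → (E →L[ℂ] F)) (U : Set ℂ), IsOpen U ∧ z₀ ∈ U ∧ AnalyticOnNhd ℂ K₀ U ∧
    ∀ z ∈ U, z ≠ z₀ → K z = K₀ z + (z - z₀)⁻¹ • R

/-- `K` has a (simple) pole at `z₀`. -/
def IsPoleAt (K : ℂ → (E →L[ℂ] F)) (z₀ : ℂ) : Prop := ∃ R, SimplePoleAt K z₀ R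

open scoped Classical in
/-- The rank of a (simple) pole of `K` at `z₀`: the rank of the residue there
(`0` if there is no simple pole at `z₀`). -/
noncomputable def poleRank (K : ℂ → (E →L[ℂ] F)) (z₀ : ℂ) : ℕ :=
  if h : ∃ R, SimplePoleAt K z₀ R then Module.finrank ℂ ↥(LinearMap.range (h.choose : E →ₗ[ℂ] F)) else 0

end Merom

/-- The domain `D_Ω = ℂ \ ((−∞,−Ω] ∪ [Ω,∞))`. -/
def DOmega (Ω : ℝ) : Set ℂ := {z : ℂ | z.im ≠ 0 ∨ |z.re| < Ω}
/-! ### Self-adjoint Hamiltonians, encoded through their projection-valued spectral measure -/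

open scoped InnerProductSpace

/-- The spectral data of a self-adjoint Hamiltonian `H`: the projection-valued spectral
measure `A ↦ P^H(A)` together with the diagonal spectral measures
`x ↦ μ_x = ⟪x, P^H(·) x⟫ = ‖P^H(·)x‖²`. -/
structure SpectralData (𝓗 : Type*) [NormedAddCommGroup 𝓗] [InnerProductSpace ℂ 𝓗] where
  proj : Set ℝ → (𝓗 →L[ℂ] 𝓗)
  diag : 𝓗 → MeasureTheory.Measure ℝ
  proj_symm : ∀ A : Set ℝ, MeasurableSet A → ∀ x y : 𝓗, ⟪proj A x, y⟫_ℂ = ⟪x, proj A y⟫_ℂ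
  proj_comp : ∀ A B : Set ℝ, MeasurableSet A → MeasurableSet B →
    proj A ∘L proj B = proj (A ∩ B)
  proj_univ : proj Set.univ = ContinuousLinearMap.id ℂ 𝓗
  diag_apply : ∀ (x : 𝓗) (A : Set ℝ), MeasurableSet A →
    diag x A = (‖proj A x‖₊ : ℝ≥0∞) ^ 2

variable {𝓗 : Type*} [NormedAddCommGroup 𝓗] [InnerProductSpace ℂ 𝓗]

/-- The spectrum `σ(H)` (the support of the spectral measure). -/
def SpectralData.spec (P : SpectralData 𝓗) : Set ℝ :=
  {a | ∀ ε > 0, P.proj (Set.Ioo (a - ε) (a + ε)) ≠ 0}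

/-- The essential spectrum `σ_ess(H)` (the points at which every spectral window has
infinite rank). -/
def SpectralData.essSpec (P : SpectralData 𝓗) : Set ℝ :=
  {a | ∀ ε > 0, ¬ FiniteDimensional ℂ ↥(LinearMap.range (P.proj (Set.Ioo (a - ε) (a + ε)) : 𝓗 →ₗ[ℂ] 𝓗))}

/-- Assumption 1: `E₀` is the ground-state energy of `H`, a simple isolated eigenvalue with
normalized ground state `Ψ₀`. -/
structure IsGroundState (P : SpectralData 𝓗) (E₀ : ℝ) (Ψ₀ : 𝓗) : Prop where
  unit : ‖Ψ₀‖ = 1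
  bottom : P.proj (Set.Iio E₀) = 0
  eig : P.proj {E₀} Ψ₀ = Ψ₀
  simple : LinearMap.range (P.proj {E₀} : 𝓗 →ₗ[ℂ] 𝓗) = Submodule.span ℂ {Ψ₀}
  isolated : ∃ ε > 0, P.proj (Set.Ioo (E₀ - ε) (E₀ + ε)) = P.proj {E₀}

section Symmetrized

variable {𝓗N 𝓗' : Type*} [NormedAddCommGroup 𝓗N] [InnerProductSpace ℂ 𝓗N]
  [CompleteSpace 𝓗N] [NormedAddCommGroup 𝓗'] [InnerProductSpace ℂ 𝓗'] [CompleteSpace 𝓗']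

/-- The set of poles of `χ̂_s` in `D_Ω`: the real `ω ≠ 0` with `|ω| < Ω` and
`T P^H_{E₀+|ω|} ≠ 0` (Section 4, eq. (4.2)). -/
def chisPoles (P : SpectralData 𝓗N) (E₀ Ω : ℝ) (T : 𝓗N →L[ℂ] 𝓗') : Set ℂ :=
  {z : ℂ | ∃ ω : ℝ, z = (ω : ℂ) ∧ ω ≠ 0 ∧ |ω| < Ω ∧ T ∘L P.proj {E₀ + |ω|} ≠ 0}

/-- `χs` is the symmetrized density-density response function
`χ̂_s(z) = T (∫_{σ(H)} 2(E₀−λ)/((E₀−λ)²−z²) dP^H_λ) T*` of eq. (4.1), characterized (by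
polarization) through its quadratic form on `D_Ω` minus the pole set. -/
def IsSymmetrizedDDRF (P : SpectralData 𝓗N) (E₀ Ω : ℝ) (T : 𝓗N →L[ℂ] 𝓗')
    (χs : ℂ → (𝓗' →L[ℂ] 𝓗')) : Prop :=
  ∀ z ∈ DOmega Ω \ chisPoles P E₀ Ω T, ∀ f : 𝓗',
    Integrable (fun lam : ℝ => (2 * ((E₀ : ℂ) - lam)) / (((E₀ : ℂ) - lam) ^ 2 - z ^ 2))
      (P.diag (T.adjoint f)) ∧
    ⟪f, χs z f⟫_ℂ = ∫ lam : ℝ,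
      (2 * ((E₀ : ℂ) - lam)) / (((E₀ : ℂ) - lam) ^ 2 - z ^ 2) ∂(P.diag (T.adjoint f))

end Symmetrized

/-- The orthogonal projection onto the orthogonal complement of a subspace `V` of a Hilbert
space, as an endomorphism. -/
noncomputable def perpProj {H : Type*} [NormedAddCommGroup H] [InnerProductSpace ℂ H]
    [CompleteSpace H] (V : Submodule ℂ H) : H →L[ℂ] H :=
  haveI : CompleteSpace ↥(Vᗮ) := V.isClosed_orthogonal.completeSpace_coe
  haveI : Submodule.HasOrthogonalProjection (Vᗮ) :=
    Submodule.HasOrthogonalProjection.ofCompleteSpace (K := Vᗮ)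
  (Vᗮ).subtypeL ∘L Submodule.orthogonalProjectionOnto Vᗮ

/-- The orthogonal projection onto (the closure of) a subspace `V` of a Hilbert space. -/
noncomputable def projOnto {H : Type*} [NormedAddCommGroup H] [InnerProductSpace ℂ H]
    [CompleteSpace H] (V : Submodule ℂ H) : H →L[ℂ] H :=
  ContinuousLinearMap.id ℂ H - perpProj V

/-- Shrinking a finite-rank spectral window along a sequence with empty intersection eventually
annihilates the spectral projection. -/
theorem SpectralData.exists_proj_eq_zero_of_antitone (P : SpectralData 𝓗) (A : ℕ → Set ℝ)
    (hA : ∀ n, MeasurableSet (A n)) (hanti : Antitone A) (hempty : ⋂ n, A n = ∅)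
    (hfin : ∀ n, FiniteDimensional ℂ ↥(LinearMap.range (P.proj (A n) : 𝓗 →ₗ[ℂ] 𝓗))) :
    ∃ n, P.proj (A n) = 0 := by
  obtain ⟨n, -, hn⟩ := WellFounded.has_min (measure fun n : ℕ =>
    Module.finrank ℂ ↥(LinearMap.range (P.proj (A n) : 𝓗 →ₗ[ℂ] 𝓗))).wf Set.univ
    Set.univ_nonempty
  refine ⟨n, ?_⟩
  have hcomp : ∀ m, n ≤ m → ∀ x, P.proj (A n) (P.proj (A m) x) = P.proj (A m) x := by
    intro m hm x
    have h := P.proj_comp _ _ (hA n) (hA m)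
    rw [Set.inter_eq_self_of_subset_right (hanti hm)] at h
    exact congrArg (fun B : 𝓗 →L[ℂ] 𝓗 => B x) h
  have hcomp' : ∀ m, n ≤ m → ∀ x, P.proj (A m) (P.proj (A n) x) = P.proj (A m) x := by
    intro m hm x
    have h := P.proj_comp _ _ (hA m) (hA n)
    rw [Set.inter_eq_self_of_subset_left (hanti hm)] at h
    exact congrArg (fun B : 𝓗 →L[ℂ] 𝓗 => B x) h
  have heq : ∀ m, n ≤ m → ∀ x, P.proj (A m) x = P.proj (A n) x := by
    intro m hm x
    have hle : LinearMap.range (P.proj (A m) : 𝓗 →ₗ[ℂ] 𝓗) ≤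
        LinearMap.range (P.proj (A n) : 𝓗 →ₗ[ℂ] 𝓗) := by
      rintro _ ⟨y, rfl⟩
      exact ⟨P.proj (A m) y, hcomp m hm y⟩
    have hrange := Submodule.eq_of_le_of_finrank_le hle (not_lt.mp (hn m (Set.mem_univ m)))
    have hx : P.proj (A n) x ∈ LinearMap.range (P.proj (A m) : 𝓗 →ₗ[ℂ] 𝓗) := by
      rw [hrange]
      exact ⟨x, rfl⟩
    obtain ⟨y, hy⟩ := hx
    have hy' : P.proj (A m) y = P.proj (A n) x := hy
    have hidem : P.proj (A m) (P.proj (A m) y) = P.proj (A m) y := by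
      have h := P.proj_comp _ _ (hA m) (hA m)
      rw [Set.inter_self] at h
      exact congrArg (fun B : 𝓗 →L[ℂ] 𝓗 => B y) h
    rw [← hcomp' m hm x, ← hy', hidem]
  ext x
  have htend := tendsto_measure_iInter_atTop (μ := P.diag x)
    (fun k => (hA k).nullMeasurableSet) hanti
    ⟨n, by rw [P.diag_apply x _ (hA n)]; exact ENNReal.pow_ne_top ENNReal.coe_ne_top⟩
  rw [hempty, measure_empty] at htend
  have hconst : Filter.Tendsto (fun k => P.diag x (A k)) Filter.atTop
      (𝓝 ((‖P.proj (A n) x‖₊ : ℝ≥0∞) ^ 2)) := by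
    refine tendsto_const_nhds.congr' ?_
    filter_upwards [Filter.eventually_ge_atTop n] with m hm
    rw [P.diag_apply x _ (hA m), heq m hm x]
  have h0 := tendsto_nhds_unique hconst htend
  simpa using h0

theorem SpectralData.finiteDimensional_range_of_subset (P : SpectralData 𝓗) {A B : Set ℝ}
    (hA : MeasurableSet A) (hB : MeasurableSet B) (hAB : A ⊆ B)
    (hfin : FiniteDimensional ℂ ↥(LinearMap.range (P.proj B : 𝓗 →ₗ[ℂ] 𝓗))) :
    FiniteDimensional ℂ ↥(LinearMap.range (P.proj A : 𝓗 →ₗ[ℂ] 𝓗)) := by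
  refine Submodule.finiteDimensional_of_le (S₂ := LinearMap.range (P.proj B : 𝓗 →ₗ[ℂ] 𝓗)) ?_
  rintro _ ⟨y, rfl⟩
  have h := P.proj_comp _ _ hB hA
  rw [Set.inter_eq_self_of_subset_right hAB] at h
  exact ⟨P.proj A y, congrArg (fun C : 𝓗 →L[ℂ] 𝓗 => C y) h⟩

/-- A point outside the essential spectrum has a punctured neighbourhood free of spectrum. -/
theorem SpectralData.exists_proj_punctured_eq_zero (P : SpectralData 𝓗) {a : ℝ}
    (ha : a ∉ P.essSpec) :
    ∃ ε > 0, P.proj (Set.Ioo (a - ε) (a + ε) \ {a}) = 0 := by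
  simp only [SpectralData.essSpec, Set.mem_ofPred_eq, not_forall, not_not] at ha
  obtain ⟨ε, hε, hfin⟩ := ha
  have hpos : ∀ n : ℕ, 0 < ε / ((n : ℝ) + 1) := fun n => by positivity
  have hmeas : ∀ n : ℕ, MeasurableSet
      (Set.Ioo (a - ε / ((n : ℝ) + 1)) (a + ε / ((n : ℝ) + 1)) \ {a}) :=
    fun n => measurableSet_Ioo.diff (measurableSet_singleton a)
  suffices h : ∃ n : ℕ,
      P.proj (Set.Ioo (a - ε / ((n : ℝ) + 1)) (a + ε / ((n : ℝ) + 1)) \ {a}) = 0 from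
    h.elim fun n hn => ⟨_, hpos n, hn⟩
  refine P.exists_proj_eq_zero_of_antitone
    (fun n : ℕ => Set.Ioo (a - ε / ((n : ℝ) + 1)) (a + ε / ((n : ℝ) + 1)) \ {a}) hmeas ?_ ?_ ?_
  · intro m n hmn
    have hle : ε / ((n : ℝ) + 1) ≤ ε / ((m : ℝ) + 1) := by gcongr
    exact Set.sdiff_subset_sdiff_left (Set.Ioo_subset_Ioo (by linarith) (by linarith))
  · rw [Set.eq_empty_iff_forall_notMem]
    intro x hx
    rw [Set.mem_iInter] at hx
    have hxa : 0 < |x - a| := abs_pos.mpr (sub_ne_zero.mpr (hx 0).2)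
    have htend : Filter.Tendsto (fun n : ℕ => ε / ((n : ℝ) + 1)) Filter.atTop (𝓝 0) := by
      simpa [div_eq_mul_inv] using
        (tendsto_one_div_add_atTop_nhds_zero_nat (𝕜 := ℝ)).const_mul ε
    obtain ⟨n, hn⟩ := (htend.eventually_lt_const hxa).exists
    have h := (hx n).1
    have : |x - a| < ε / ((n : ℝ) + 1) := abs_lt.mpr ⟨by linarith [h.1], by linarith [h.2]⟩
    linarith
  · intro n
    refine P.finiteDimensional_range_of_subset (hmeas n) measurableSet_Ioo ?_ hfin
    have hle : ε / ((n : ℝ) + 1) ≤ ε := div_le_self hε.le (by linarith [n.cast_nonneg (α := ℝ)])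
    exact Set.sdiff_subset.trans (Set.Ioo_subset_Ioo (by linarith) (by linarith))

theorem SpectralData.diag_eq_zero_of_proj_apply_eq_zero (P : SpectralData 𝓗) {A : Set ℝ}
    (hA : MeasurableSet A) {x : 𝓗} (h : P.proj A x = 0) : P.diag x A = 0 := by
  simp [P.diag_apply x A hA, h]

/-- The diagonal spectral measure of `x` vanishes on a set of non-essential points which carry no
component of `x`. -/
theorem SpectralData.diag_eq_zero_of_forall_singleton (P : SpectralData 𝓗) {S : Set ℝ} {x : 𝓗}
    (hS : ∀ a ∈ S, a ∉ P.essSpec) (hx : ∀ a ∈ S, P.proj {a} x = 0) : P.diag x S = 0 := by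
  refine measure_null_of_locally_null S fun a ha => ?_
  obtain ⟨ε, hε, hP⟩ := P.exists_proj_punctured_eq_zero (hS a ha)
  refine ⟨Set.Ioo (a - ε) (a + ε),
    mem_nhdsWithin_of_mem_nhds (Ioo_mem_nhds (by linarith) (by linarith)), ?_⟩
  refine measure_mono_null (t := (Set.Ioo (a - ε) (a + ε) \ {a}) ∪ {a}) ?_
    (measure_union_null ?_ ?_)
  · intro y hy
    by_cases h : y = a
    · exact Or.inr h
    · exact Or.inl ⟨hy, h⟩
  · exact P.diag_eq_zero_of_proj_apply_eq_zero
      (measurableSet_Ioo.diff (measurableSet_singleton a)) (by simp [hP])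
  · exact P.diag_eq_zero_of_proj_apply_eq_zero (measurableSet_singleton a) (hx a ha)

theorem SpectralData.bddBelow_essSpec (P : SpectralData 𝓗) {E₀ : ℝ}
    (h : P.proj (Set.Iio E₀) = 0) : BddBelow P.essSpec := by
  refine ⟨E₀, fun a ha => ?_⟩
  by_contra! hlt
  refine ha (E₀ - a) (by linarith) ?_
  refine P.finiteDimensional_range_of_subset measurableSet_Ioo measurableSet_Iio
    (B := Set.Iio E₀) (fun y hy => ?_) ?_
  · have := hy.2
    simp only [Set.mem_Iio]
    linarith
  · have hbot : LinearMap.range (P.proj (Set.Iio E₀) : 𝓗 →ₗ[ℂ] 𝓗) = ⊥ := by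
      rw [eq_bot_iff]
      rintro _ ⟨y, rfl⟩
      simp [h]
    rw [hbot]
    infer_instance

theorem SpectralData.proj_adjoint_apply_eq_zero [CompleteSpace 𝓗] {𝓚 : Type*}
    [NormedAddCommGroup 𝓚] [InnerProductSpace ℂ 𝓚] [CompleteSpace 𝓚] (P : SpectralData 𝓗)
    {A : Set ℝ} (hA : MeasurableSet A) {T : 𝓗 →L[ℂ] 𝓚} (h : T ∘L P.proj A = 0) (f : 𝓚) :
    P.proj A (T.adjoint f) = 0 := by
  refine ext_inner_right ℂ fun y => ?_
  have hy : T (P.proj A y) = 0 := congrArg (fun B : 𝓗 →L[ℂ] 𝓚 => B y) h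
  rw [P.proj_symm A hA, ContinuousLinearMap.adjoint_inner_left, hy, inner_zero_right,
    inner_zero_left]

theorem response_integrand_re_im (E₀ lam : ℝ) (z : ℂ) :
    ((2 * ((E₀ : ℂ) - lam)) / (((E₀ : ℂ) - lam) ^ 2 - z ^ 2)).re =
        2 * (lam - E₀) * (z.re ^ 2 - z.im ^ 2 - (lam - E₀) ^ 2) /
          normSq (((E₀ : ℂ) - lam) ^ 2 - z ^ 2) ∧
      ((2 * ((E₀ : ℂ) - lam)) / (((E₀ : ℂ) - lam) ^ 2 - z ^ 2)).im =
        -(4 * (lam - E₀) * (z.re * z.im)) / normSq (((E₀ : ℂ) - lam) ^ 2 - z ^ 2) := by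
  have hr : (((E₀ : ℂ) - lam) ^ 2 - z ^ 2).re = (lam - E₀) ^ 2 - z.re ^ 2 + z.im ^ 2 := by
    simp [pow_two]; ring
  have hi : (((E₀ : ℂ) - lam) ^ 2 - z ^ 2).im = -(2 * (z.re * z.im)) := by
    simp [pow_two]; ring
  have hr' : (2 * ((E₀ : ℂ) - lam)).re = 2 * (E₀ - lam) := by simp
  have hi' : (2 * ((E₀ : ℂ) - lam)).im = 0 := by simp
  rw [div_re, div_im, hr, hi, hr', hi']
  constructor <;> ring

/-- Pointwise bound behind the real-to-imaginary ratio; `s` is a sign of `ω η`. -/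
theorem response_integrand_re_le {E₀ lam w s C : ℝ} {z : ℂ} (hw : 0 < w)
    (hlam : lam = E₀ ∨ E₀ + w ≤ lam) (hs : s * (z.re * z.im) = |z.re * z.im|) (hC : 0 ≤ C)
    (hCz : z.re ^ 2 - z.im ^ 2 - w ^ 2 ≤ C * |z.re * z.im|) :
    ((2 * ((E₀ : ℂ) - lam)) / (((E₀ : ℂ) - lam) ^ 2 - z ^ 2)).re ≤
      -(C * s) * ((2 * ((E₀ : ℂ) - lam)) / (((E₀ : ℂ) - lam) ^ 2 - z ^ 2)).im := by
  obtain ⟨hre, him⟩ := response_integrand_re_im E₀ lam z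
  rw [hre, him, ← mul_div_assoc]
  refine div_le_div_of_nonneg_right ?_ (normSq_nonneg _)
  have hrhs : -(C * s) * -(4 * (lam - E₀) * (z.re * z.im)) =
      2 * (lam - E₀) * (2 * (C * |z.re * z.im|)) := by
    rw [← hs]; ring
  rw [hrhs]
  rcases hlam with rfl | h
  · simp
  · refine mul_le_mul_of_nonneg_left ?_ (by linarith)
    have hCa : 0 ≤ C * |z.re * z.im| := mul_nonneg hC (abs_nonneg _)
    nlinarith

/-- Lemma 4.4, real-to-imaginary ratio: for every
`z = ω + iη ∈ D_Ω ∖ ((−Ω,−ω₁] ∪ [ω₁,Ω))` and `f ∈ 𝓗`,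
`Re⟨f, χ̂_s(z) f⟩ ≤ max{0, (ω²−η²−ω₁²)/|ωη|} · |Im⟨f, χ̂_s(z) f⟩|`,
where `ω₁` is the smallest pole of `χ̂_s` in `(0,Ω)` (and `ω₁ = Ω` if there is none). -/
theorem symmetrized_ddrf_real_to_imaginary_ratio
    {𝓗N 𝓗' : Type*} [NormedAddCommGroup 𝓗N] [InnerProductSpace ℂ 𝓗N] [CompleteSpace 𝓗N]
    [NormedAddCommGroup 𝓗'] [InnerProductSpace ℂ 𝓗'] [CompleteSpace 𝓗']
    (P : SpectralData 𝓗N) (E₀ : ℝ) (Ψ₀ : 𝓗N) (hgs : IsGroundState P E₀ Ψ₀)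
    (Ω : ℝ) (hness : P.essSpec.Nonempty) (hΩ : Ω = sInf P.essSpec - E₀) (hΩpos : 0 < Ω)
    (T : 𝓗N →L[ℂ] 𝓗')
    (χs : ℂ → (𝓗' →L[ℂ] 𝓗')) (hχs : IsSymmetrizedDDRF P E₀ Ω T χs)
    -- `ω₁` is the smallest pole of `χ̂_s` in `(0,Ω)`, or `Ω` if there is none
    (ω₁ : ℝ) (hω₁pos : 0 < ω₁)
    (hω₁mem : (ω₁ : ℂ) ∈ chisPoles P E₀ Ω T ∨ ω₁ = Ω)
    (hω₁min : ∀ x : ℝ, 0 < x → (x : ℂ) ∈ chisPoles P E₀ Ω T → ω₁ ≤ x) :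
    ∀ z : ℂ, z ∈ DOmega Ω → (z.im ≠ 0 ∨ |z.re| < ω₁) → ∀ f : 𝓗',
      (⟪f, χs z f⟫_ℂ).re ≤
        max 0 ((z.re ^ 2 - z.im ^ 2 - ω₁ ^ 2) / |z.re * z.im|) * |(⟪f, χs z f⟫_ℂ).im| := by
  subst hΩ
  intro z hz hz' f
  have hω₁le : ω₁ ≤ sInf P.essSpec - E₀ := by
    rcases hω₁mem with ⟨ω, hω, -, hlt, -⟩ | h
    · rw [ofReal_inj.mp hω]
      exact (le_abs_self ω).trans hlt.le
    · exact h.le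
  have hzpole : z ∉ chisPoles P E₀ (sInf P.essSpec - E₀) T := by
    rintro ⟨ω, rfl, hne, hlt, hT⟩
    have hmin := hω₁min |ω| (abs_pos.mpr hne)
      ⟨|ω|, rfl, abs_ne_zero.mpr hne, by rwa [abs_abs], by rwa [abs_abs]⟩
    rcases hz' with h | h
    · exact h (ofReal_im ω)
    · rw [ofReal_re] at h
      linarith
  obtain ⟨hint, hval⟩ := hχs z ⟨hz, hzpole⟩ f
  have hneg : P.diag (T.adjoint f) (Set.Iio E₀) = 0 :=
    P.diag_eq_zero_of_proj_apply_eq_zero measurableSet_Iio (by simp [hgs.bottom])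
  have hgap : P.diag (T.adjoint f) (Set.Ioo E₀ (E₀ + ω₁)) = 0 := by
    refine P.diag_eq_zero_of_forall_singleton (fun a ha hess => ?_) fun a ha => ?_
    · have := csInf_le (P.bddBelow_essSpec hgs.bottom) hess
      linarith [ha.2]
    · refine P.proj_adjoint_apply_eq_zero (measurableSet_singleton a) ?_ f
      by_contra hT
      have hpos : 0 < a - E₀ := sub_pos.mpr ha.1
      have := hω₁min (a - E₀) hpos ⟨a - E₀, rfl, hpos.ne', by
        rw [abs_of_pos hpos]; linarith [ha.2], by
        rwa [abs_of_pos hpos, add_sub_cancel]⟩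
      linarith [ha.2]
  have hae : ∀ᵐ lam ∂(P.diag (T.adjoint f)), lam = E₀ ∨ E₀ + ω₁ ≤ lam := by
    rw [ae_iff]
    refine measure_mono_null (fun lam hlam => ?_) (measure_union_null hneg hgap)
    simp only [Set.mem_ofPred_eq, not_or, not_le] at hlam
    rcases lt_or_gt_of_ne hlam.1 with h | h
    · exact Or.inl h
    · exact Or.inr ⟨h, hlam.2⟩
  set C := max 0 ((z.re ^ 2 - z.im ^ 2 - ω₁ ^ 2) / |z.re * z.im|) with hCdef
  have hC : 0 ≤ C := le_max_left _ _
  have hCz : z.re ^ 2 - z.im ^ 2 - ω₁ ^ 2 ≤ C * |z.re * z.im| := by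
    by_cases h0 : z.re * z.im = 0
    · rw [h0, abs_zero, mul_zero]
      rcases mul_eq_zero.mp h0 with h | h
      · rw [h]
        nlinarith [sq_nonneg z.im, sq_nonneg ω₁]
      · have hlt : |z.re| < ω₁ := hz'.resolve_left (not_not.mpr h)
        have := sq_lt_sq' (abs_lt.mp hlt).1 (abs_lt.mp hlt).2
        rw [h]
        linarith
    · exact (div_le_iff₀ (abs_pos.mpr h0)).mp (le_max_right _ _)
  obtain ⟨s, hs1, hs⟩ : ∃ s : ℝ, |s| = 1 ∧ s * (z.re * z.im) = |z.re * z.im| := by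
    rcases le_total 0 (z.re * z.im) with h | h
    · exact ⟨1, by simp, by rw [abs_of_nonneg h, one_mul]⟩
    · exact ⟨-1, by simp, by rw [abs_of_nonpos h, neg_one_mul]⟩
  rw [hval]
  set F : ℝ → ℂ := fun lam =>
    (2 * ((E₀ : ℂ) - lam)) / (((E₀ : ℂ) - lam) ^ 2 - z ^ 2) with hF
  have hre : ∫ lam, (F lam).re ∂(P.diag (T.adjoint f)) =
      (∫ lam, F lam ∂(P.diag (T.adjoint f))).re := reCLM.integral_comp_comm hint
  have him : ∫ lam, (F lam).im ∂(P.diag (T.adjoint f)) =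
      (∫ lam, F lam ∂(P.diag (T.adjoint f))).im := imCLM.integral_comp_comm hint
  have hmono : ∫ lam, (F lam).re ∂(P.diag (T.adjoint f)) ≤
      ∫ lam, -(C * s) * (F lam).im ∂(P.diag (T.adjoint f)) := by
    refine integral_mono_ae hint.re (hint.im.const_mul _) ?_
    filter_upwards [hae] with lam hlam
    exact response_integrand_re_le hω₁pos hlam hs hC hCz
  rw [integral_const_mul, hre, him] at hmono
  refine hmono.trans ((le_abs_self _).trans_eq ?_)
  rw [abs_mul, abs_neg, abs_mul, hs1, mul_one, abs_of_nonneg hC]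

end
end

section
/- Let χ̂_s(z) = T (∫_{σ(H)} 2(E₀−λ)/((E₀−λ)²−z²) dP^H_λ) T* with H self-adjoint on ⋀^N L²(ℝ³) satisfying the standing assumptions and T ∈ B(⋀^N L²(ℝ³), 𝓗), let ω₁ be the smallest pole of χ̂_s in (0,Ω), and let μ₀ > 0. Then μ₀ − χ̂_s(z) is invertible in B(𝓗) for every z = ω + iη ∈ D_Ω with η ≠ 0 or |ω| < ω₁, and for all nonreal z one has the blow-up estimate ‖(μ₀ − χ̂_s(ω+iη))^{−1}‖ ≤ C μ₀^{−1} |z| |η|^{−1} for a constant C independent of μ₀, z. -/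
open MeasureTheory ENNReal NNReal Complex Asymptotics
open scoped InnerProductSpace Topology
noncomputable section

/-! ### Self-adjoint Hamiltonians, encoded through their projection-valued spectral measure -/

open scoped InnerProductSpace

variable {𝓗 : Type*} [NormedAddCommGroup 𝓗] [InnerProductSpace ℂ 𝓗]

section CoerciveInverse

variable {H : Type*} [NormedAddCommGroup H] [InnerProductSpace ℂ H] [CompleteSpace H]

theorem isUnit_of_le_norm_inner {A : H →L[ℂ] H} {c : ℝ} (hc : 0 < c)
    (h : ∀ f, c * ‖f‖ ^ 2 ≤ ‖⟪f, A f⟫_ℂ‖) : IsUnit A := by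
  refine ContinuousLinearMap.isUnit_of_forall_le_norm_inner_map A (c := ⟨c, hc.le⟩) hc fun f => ?_
  rw [norm_inner_symm, mul_comm]
  exact h f

theorem norm_ringInverse_le_of_le_norm_inner {A : H →L[ℂ] H} {c : ℝ} (hc : 0 < c)
    (h : ∀ f, c * ‖f‖ ^ 2 ≤ ‖⟪f, A f⟫_ℂ‖) : ‖Ring.inverse A‖ ≤ c⁻¹ := by
  have hA := isUnit_of_le_norm_inner hc h
  refine ContinuousLinearMap.opNorm_le_bound _ (inv_nonneg.2 hc.le) fun y => ?_
  set x := Ring.inverse A y with hx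
  have hAx : A x = y := by
    have := congrArg (fun B : H →L[ℂ] H => B y) (Ring.mul_inverse_cancel A hA)
    simpa using this
  have h1 : c * ‖x‖ ^ 2 ≤ ‖x‖ * ‖y‖ := by
    have := (h x).trans (norm_inner_le_norm x (A x))
    rwa [hAx] at this
  rw [inv_mul_eq_div, le_div_iff₀ hc]
  rcases (norm_nonneg x).eq_or_lt with h0 | h0
  · rw [← h0, zero_mul]
    exact norm_nonneg y
  · nlinarith

end CoerciveInverse

namespace SpectralData

theorem proj_apply_proj (P : SpectralData 𝓗) {A B : Set ℝ} (hA : MeasurableSet A)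
    (hB : MeasurableSet B) (x : 𝓗) : P.proj A (P.proj B x) = P.proj (A ∩ B) x := by
  rw [← P.proj_comp A B hA hB, ContinuousLinearMap.comp_apply]

theorem diag_eq_zero_iff (P : SpectralData 𝓗) {A : Set ℝ} (hA : MeasurableSet A) (x : 𝓗) :
    P.diag x A = 0 ↔ P.proj A x = 0 := by
  simp [P.diag_apply x A hA]

theorem diag_ne_top (P : SpectralData 𝓗) {A : Set ℝ} (hA : MeasurableSet A) (x : 𝓗) :
    P.diag x A ≠ ∞ := by
  simp [P.diag_apply x A hA]

theorem range_proj_mono (P : SpectralData 𝓗) {A B : Set ℝ} (hA : MeasurableSet A)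
    (hB : MeasurableSet B) (hAB : A ⊆ B) :
    LinearMap.range (P.proj A : 𝓗 →ₗ[ℂ] 𝓗) ≤ LinearMap.range (P.proj B : 𝓗 →ₗ[ℂ] 𝓗) := by
  rintro _ ⟨x, rfl⟩
  refine ⟨P.proj A x, ?_⟩
  simp [P.proj_apply_proj hB hA, Set.inter_eq_right.2 hAB]

theorem proj_eq_of_finrank_le (P : SpectralData 𝓗) {A B : Set ℝ} (hA : MeasurableSet A)
    (hB : MeasurableSet B) (hAB : A ⊆ B)
    (hfin : FiniteDimensional ℂ ↥(LinearMap.range (P.proj B : 𝓗 →ₗ[ℂ] 𝓗)))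
    (hrank : Module.finrank ℂ ↥(LinearMap.range (P.proj B : 𝓗 →ₗ[ℂ] 𝓗)) ≤
      Module.finrank ℂ ↥(LinearMap.range (P.proj A : 𝓗 →ₗ[ℂ] 𝓗))) :
    P.proj A = P.proj B := by
  have hr := Submodule.eq_of_le_of_finrank_le (P.range_proj_mono hA hB hAB) hrank
  ext x
  have hx : P.proj B x ∈ LinearMap.range (P.proj A : 𝓗 →ₗ[ℂ] 𝓗) := hr ▸ ⟨x, rfl⟩
  obtain ⟨y, hy⟩ := hx
  replace hy : P.proj A y = P.proj B x := hy
  have h1 := P.proj_apply_proj hA hB x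
  rwa [← hy, P.proj_apply_proj hA hA, Set.inter_self, Set.inter_eq_left.2 hAB, hy, eq_comm] at h1

/-- Off the essential spectrum the diagonal spectral measures are locally carried by an atom. -/
theorem exists_diag_Ioo_eq_zero (P : SpectralData 𝓗) {a : ℝ} (ha : a ∉ P.essSpec) {x : 𝓗}
    (hx : P.diag x {a} = 0) : ∃ δ > 0, P.diag x (Set.Ioo (a - δ) (a + δ)) = 0 := by
  simp only [essSpec, Set.mem_ofPred_eq, not_forall, not_not] at ha
  obtain ⟨ε, hε, hfin⟩ := ha
  let w : ℝ → Set ℝ := fun δ => Set.Ioo (a - δ) (a + δ)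
  let r : ℝ → ℕ := fun δ => Module.finrank ℂ ↥(LinearMap.range (P.proj (w δ) : 𝓗 →ₗ[ℂ] 𝓗))
  have hw : ∀ δ, MeasurableSet (w δ) := fun δ => measurableSet_Ioo
  have hmono : ∀ {δ δ'}, δ ≤ δ' → w δ ⊆ w δ' := fun h =>
    Set.Ioo_subset_Ioo (by linarith) (by linarith)
  obtain ⟨δ, ⟨hδ, hδε⟩, hmin⟩ : ∃ δ ∈ Set.Ioc 0 ε, ∀ δ' ∈ Set.Ioc 0 ε, r δ ≤ r δ' := by
    have hne : (r '' Set.Ioc 0 ε).Nonempty := ⟨r ε, ε, ⟨hε, le_rfl⟩, rfl⟩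
    obtain ⟨δ, hδ, hr⟩ := Nat.sInf_mem hne
    exact ⟨δ, hδ, fun δ' hδ' => hr ▸ Nat.sInf_le ⟨δ', hδ', rfl⟩⟩
  have hfinδ : FiniteDimensional ℂ ↥(LinearMap.range (P.proj (w δ) : 𝓗 →ₗ[ℂ] 𝓗)) :=
    Submodule.finiteDimensional_of_le (P.range_proj_mono (hw δ) (hw ε) (hmono hδε))
  have hnull : ∀ n : ℕ, P.diag x (w δ \ w (δ / (n + 1))) = 0 := fun n => by
    have hle : δ / (n + 1) ≤ δ := div_le_self hδ.le (by linarith [n.cast_nonneg (α := ℝ)])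
    have heq := P.proj_eq_of_finrank_le (hw _) (hw δ) (hmono hle) hfinδ
      (hmin _ ⟨by positivity, hle.trans hδε⟩)
    rw [measure_sdiff (hmono hle) (hw _).nullMeasurableSet (P.diag_ne_top (hw _) x),
      P.diag_apply x _ (hw _), P.diag_apply x _ (hw _), heq, tsub_self]
  refine ⟨δ, hδ, measure_mono_null (t := {a} ∪ ⋃ n : ℕ, w δ \ w (δ / (n + 1))) ?_
    (measure_union_null hx (measure_iUnion_null hnull))⟩
  intro b hb
  by_cases hba : b = a
  · exact Or.inl hba
  · have hpos : 0 < |b - a| / δ := div_pos (abs_pos.2 (sub_ne_zero.2 hba)) hδ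
    obtain ⟨n, hn⟩ := exists_nat_one_div_lt hpos
    refine Or.inr (Set.mem_iUnion.2 ⟨n, hb, fun hbn => ?_⟩)
    have h1 : |b - a| < δ / (n + 1) := abs_sub_lt_iff.2 ⟨by linarith [hbn.2], by linarith [hbn.1]⟩
    rw [lt_div_iff₀ hδ] at hn
    rw [div_mul_eq_mul_div, one_mul] at hn
    exact absurd h1 hn.not_gt

theorem diag_Iio_eq_zero {P : SpectralData 𝓗} {E₀ : ℝ} {Ψ₀ : 𝓗} (hgs : IsGroundState P E₀ Ψ₀)
    (x : 𝓗) : P.diag x (Set.Iio E₀) = 0 := by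
  rw [P.diag_eq_zero_iff measurableSet_Iio, hgs.bottom, _root_.zero_apply]

theorem essSpec_subset_Ici {P : SpectralData 𝓗} {E₀ : ℝ} {Ψ₀ : 𝓗}
    (hgs : IsGroundState P E₀ Ψ₀) : P.essSpec ⊆ Set.Ici E₀ := by
  intro a ha
  by_contra h
  rw [Set.mem_Ici, not_le] at h
  have hsub : Set.Ioo (a - (E₀ - a)) (a + (E₀ - a)) ⊆ Set.Iio E₀ := fun b hb => by
    have := hb.2
    rw [Set.mem_Iio]
    linarith
  refine ha (E₀ - a) (sub_pos.2 h)
    (@Submodule.finiteDimensional_of_le _ _ _ _ _ _ _ ?_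
      (P.range_proj_mono measurableSet_Ioo measurableSet_Iio hsub))
  rw [hgs.bottom, ContinuousLinearMap.toLinearMap_zero, LinearMap.range_zero]
  infer_instance

end SpectralData

section SymmetrizedKernel

theorem im_mul_im_mul_kernel_nonpos {r : ℝ} (hr : r ≤ 0) (z : ℂ) :
    z.im * (z * ((2 * (r : ℂ)) / ((r : ℂ) ^ 2 - z ^ 2))).im ≤ 0 := by
  have key : z.im * (z * ((2 * (r : ℂ)) / ((r : ℂ) ^ 2 - z ^ 2))).im =
      2 * r * (z.im ^ 2 * (r ^ 2 + z.re ^ 2 + z.im ^ 2)) /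
        Complex.normSq ((r : ℂ) ^ 2 - z ^ 2) := by
    rw [← mul_div_assoc, Complex.div_im]
    simp only [pow_two, Complex.mul_im, Complex.mul_re, Complex.sub_re, Complex.sub_im,
      Complex.ofReal_re, Complex.ofReal_im, Complex.re_ofNat, Complex.im_ofNat]
    ring
  rw [key]
  exact div_nonpos_of_nonpos_of_nonneg
    (mul_nonpos_of_nonpos_of_nonneg (by linarith) (by positivity)) (Complex.normSq_nonneg _)

theorem kernel_re_nonpos {r x : ℝ} (hr : r ≤ 0) (hrx : r = 0 ∨ |x| ≤ |r|) :
    ((2 * (r : ℂ)) / ((r : ℂ) ^ 2 - (x : ℂ) ^ 2)).re ≤ 0 := by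
  have key : (2 * (r : ℂ)) / ((r : ℂ) ^ 2 - (x : ℂ) ^ 2) =
      ((2 * r / (r ^ 2 - x ^ 2) : ℝ) : ℂ) := by push_cast; rfl
  rw [key, Complex.ofReal_re]
  rcases hrx with rfl | h
  · simp
  · exact div_nonpos_of_nonpos_of_nonneg (by linarith) (sub_nonneg.2 (sq_le_sq.2 h))

variable {𝓗N 𝓗' : Type*} [NormedAddCommGroup 𝓗N] [InnerProductSpace ℂ 𝓗N]
  [NormedAddCommGroup 𝓗'] [InnerProductSpace ℂ 𝓗']

theorem inner_smul_one_sub_apply (μ₀ : ℝ) (A : 𝓗' →L[ℂ] 𝓗') (f : 𝓗') :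
    ⟪f, ((μ₀ : ℂ) • (1 : 𝓗' →L[ℂ] 𝓗') - A) f⟫_ℂ = ((μ₀ * ‖f‖ ^ 2 : ℝ) : ℂ) - ⟪f, A f⟫_ℂ := by
  simp [inner_self_eq_norm_sq_to_K]

theorem notMem_chisPoles_of_im_ne_zero (P : SpectralData 𝓗N) (E₀ Ω : ℝ) (T : 𝓗N →L[ℂ] 𝓗') {z : ℂ}
    (hz : z.im ≠ 0) : z ∉ chisPoles P E₀ Ω T := by
  rintro ⟨ω, rfl, -⟩
  exact hz (Complex.ofReal_im ω)

variable [CompleteSpace 𝓗N] [CompleteSpace 𝓗']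

theorem IsSymmetrizedDDRF.le_norm_inner_of_im_ne_zero {P : SpectralData 𝓗N} {E₀ Ω : ℝ} {Ψ₀ : 𝓗N}
    (hgs : IsGroundState P E₀ Ψ₀) {T : 𝓗N →L[ℂ] 𝓗'} {χs : ℂ → (𝓗' →L[ℂ] 𝓗')}
    (hχs : IsSymmetrizedDDRF P E₀ Ω T χs) (μ₀ : ℝ) {z : ℂ} (hz : z.im ≠ 0) (f : 𝓗') :
    μ₀ * |z.im| / ‖z‖ * ‖f‖ ^ 2 ≤ ‖⟪f, ((μ₀ : ℂ) • (1 : 𝓗' →L[ℂ] 𝓗') - χs z) f⟫_ℂ‖ := by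
  obtain ⟨hint, hform⟩ := hχs z ⟨Or.inl hz, notMem_chisPoles_of_im_ne_zero P E₀ Ω T hz⟩ f
  have hI : z.im * (z * ⟪f, χs z f⟫_ℂ).im ≤ 0 := by
    have h1 : (z * ⟪f, χs z f⟫_ℂ).im = ∫ lam : ℝ,
        (z * ((2 * ((E₀ : ℂ) - lam)) / (((E₀ : ℂ) - lam) ^ 2 - z ^ 2))).im
          ∂(P.diag (T.adjoint f)) := by
      rw [hform, ← integral_const_mul]
      exact (Complex.imCLM.integral_comp_comm (hint.const_mul z)).symm
    rw [h1, ← integral_const_mul]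
    refine integral_nonpos_of_ae ?_
    have hae : ∀ᵐ lam ∂(P.diag (T.adjoint f)), lam ∉ Set.Iio E₀ :=
      measure_eq_zero_iff_ae_notMem.1 (SpectralData.diag_Iio_eq_zero hgs _)
    filter_upwards [hae] with lam hlam
    have hr : E₀ - lam ≤ 0 := by
      rw [Set.mem_Iio, not_lt] at hlam
      linarith
    simpa using im_mul_im_mul_kernel_nonpos hr z
  have hzpos : 0 < ‖z‖ := norm_pos_iff.2 fun h => hz (by simp [h])
  set B := ⟪f, ((μ₀ : ℂ) • (1 : 𝓗' →L[ℂ] 𝓗') - χs z) f⟫_ℂ with hB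
  have hzB : z.im ^ 2 * (μ₀ * ‖f‖ ^ 2) ≤ z.im * (z * B).im := by
    rw [hB, inner_smul_one_sub_apply, mul_sub, Complex.sub_im, Complex.im_mul_ofReal]
    nlinarith
  have hup : z.im * (z * B).im ≤ |z.im| * (‖z‖ * ‖B‖) := by
    rw [← norm_mul]
    exact (le_abs_self _).trans ((abs_mul _ _).trans_le
      (mul_le_mul_of_nonneg_left (Complex.abs_im_le_norm _) (abs_nonneg _)))
  have hη : 0 < |z.im| := abs_pos.2 hz
  rw [div_mul_eq_mul_div, div_le_iff₀ hzpos]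
  rw [← sq_abs] at hzB
  refine le_of_mul_le_mul_left ?_ hη
  linarith

theorem diag_adjoint_singleton_eq_zero (P : SpectralData 𝓗N) {T : 𝓗N →L[ℂ] 𝓗'} {a : ℝ}
    (h : T ∘L P.proj {a} = 0) (f : 𝓗') : P.diag (T.adjoint f) {a} = 0 := by
  rw [P.diag_eq_zero_iff (measurableSet_singleton a), ← inner_self_eq_zero (𝕜 := ℂ),
    P.proj_symm _ (measurableSet_singleton a), ContinuousLinearMap.adjoint_inner_left,
    P.proj_apply_proj (measurableSet_singleton a) (measurableSet_singleton a), Set.inter_self]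
  rw [← ContinuousLinearMap.comp_apply, h, _root_.zero_apply, inner_zero_right]

theorem diag_adjoint_Ioo_eq_zero {P : SpectralData 𝓗N} {E₀ Ω ω₁ : ℝ} {Ψ₀ : 𝓗N}
    (hgs : IsGroundState P E₀ Ψ₀) (hΩ : Ω = sInf P.essSpec - E₀) {T : 𝓗N →L[ℂ] 𝓗'}
    (hω₁ : ω₁ ≤ Ω) (hmin : ∀ x : ℝ, 0 < x → (x : ℂ) ∈ chisPoles P E₀ Ω T → ω₁ ≤ x) (f : 𝓗') :
    P.diag (T.adjoint f) (Set.Ioo E₀ (E₀ + ω₁)) = 0 := by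
  refine measure_null_of_locally_null _ fun a ha => ?_
  have ht : 0 < a - E₀ := sub_pos.2 ha.1
  have hess : a ∉ P.essSpec := fun h => by
    have := csInf_le ⟨E₀, fun b hb => SpectralData.essSpec_subset_Ici hgs hb⟩ h
    linarith [ha.2]
  have hT : T ∘L P.proj {a} = 0 := by
    by_contra hne
    have hpole : ((a - E₀ : ℝ) : ℂ) ∈ chisPoles P E₀ Ω T :=
      ⟨a - E₀, rfl, ht.ne', by rw [abs_of_pos ht]; linarith [ha.2], by
        rwa [abs_of_pos ht, add_sub_cancel]⟩
    linarith [hmin _ ht hpole, ha.2]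
  obtain ⟨δ, hδ, hnull⟩ := P.exists_diag_Ioo_eq_zero hess (diag_adjoint_singleton_eq_zero P hT f)
  exact ⟨_, mem_nhdsWithin_of_mem_nhds (Ioo_mem_nhds (by linarith) (by linarith)), hnull⟩

theorem IsSymmetrizedDDRF.le_norm_inner_of_real {P : SpectralData 𝓗N} {E₀ Ω ω₁ : ℝ} {Ψ₀ : 𝓗N}
    (hgs : IsGroundState P E₀ Ψ₀) (hΩ : Ω = sInf P.essSpec - E₀) {T : 𝓗N →L[ℂ] 𝓗'}
    {χs : ℂ → (𝓗' →L[ℂ] 𝓗')} (hχs : IsSymmetrizedDDRF P E₀ Ω T χs) (hω₁ : ω₁ ≤ Ω)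
    (hmin : ∀ x : ℝ, 0 < x → (x : ℂ) ∈ chisPoles P E₀ Ω T → ω₁ ≤ x)
    (μ₀ : ℝ) {x : ℝ} (hx : |x| < ω₁) (f : 𝓗') :
    μ₀ * ‖f‖ ^ 2 ≤ ‖⟪f, ((μ₀ : ℂ) • (1 : 𝓗' →L[ℂ] 𝓗') - χs x) f⟫_ℂ‖ := by
  have hpole : (x : ℂ) ∉ chisPoles P E₀ Ω T := by
    rintro ⟨ω, hω, hω0, hωΩ, hne⟩
    obtain rfl : x = ω := Complex.ofReal_injective hω
    refine absurd (hmin |x| (abs_pos.2 hω0) ⟨|x|, rfl, (abs_pos.2 hω0).ne', ?_, ?_⟩) hx.not_ge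
    · rwa [abs_abs]
    · rwa [abs_abs]
  obtain ⟨hint, hform⟩ := hχs x ⟨Or.inr (by simpa using hx.trans_le hω₁), hpole⟩ f
  have hI : (⟪f, χs x f⟫_ℂ).re ≤ 0 := by
    have h1 : (⟪f, χs x f⟫_ℂ).re = ∫ lam : ℝ,
        ((2 * ((E₀ : ℂ) - lam)) / (((E₀ : ℂ) - lam) ^ 2 - (x : ℂ) ^ 2)).re
          ∂(P.diag (T.adjoint f)) := by
      rw [hform]
      exact (Complex.reCLM.integral_comp_comm hint).symm
    rw [h1]
    refine integral_nonpos_of_ae ?_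
    have hae : ∀ᵐ lam ∂(P.diag (T.adjoint f)), lam ∉ Set.Iio E₀ :=
      measure_eq_zero_iff_ae_notMem.1 (SpectralData.diag_Iio_eq_zero hgs _)
    have hae' : ∀ᵐ lam ∂(P.diag (T.adjoint f)), lam ∉ Set.Ioo E₀ (E₀ + ω₁) :=
      measure_eq_zero_iff_ae_notMem.1 (diag_adjoint_Ioo_eq_zero hgs hΩ hω₁ hmin f)
    filter_upwards [hae, hae'] with lam h0 hgap
    rw [Set.mem_Iio, not_lt] at h0
    have hr : E₀ - lam ≤ 0 := by linarith
    have hrx : E₀ - lam = 0 ∨ |x| ≤ |E₀ - lam| := by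
      rcases h0.eq_or_lt with h | h
      · exact Or.inl (sub_eq_zero.2 h)
      · refine Or.inr ?_
        rw [abs_of_nonpos hr]
        have : E₀ + ω₁ ≤ lam := not_lt.1 fun hlt => hgap ⟨h, hlt⟩
        linarith
    simpa using kernel_re_nonpos hr hrx
  refine le_trans ?_ (Complex.re_le_norm _)
  rw [inner_smul_one_sub_apply, Complex.sub_re, Complex.ofReal_re]
  linarith

end SymmetrizedKernel

/-- Lemma 4.5: for `μ₀ > 0`, the operator `μ₀ − χ̂_s(z)` is invertible for
every `z = ω + iη ∈ D_Ω` with `η ≠ 0` or `|ω| < ω₁`, and for nonreal `z` one has the blow-up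
estimate `‖(μ₀ − χ̂_s(ω+iη))⁻¹‖ ≤ C μ₀⁻¹ |z| |η|⁻¹` with `C` independent of `μ₀` and `z`. -/
theorem symmetrized_ddrf_resolvent_bound
    {𝓗N 𝓗' : Type*} [NormedAddCommGroup 𝓗N] [InnerProductSpace ℂ 𝓗N] [CompleteSpace 𝓗N]
    [NormedAddCommGroup 𝓗'] [InnerProductSpace ℂ 𝓗'] [CompleteSpace 𝓗']
    (P : SpectralData 𝓗N) (E₀ : ℝ) (Ψ₀ : 𝓗N) (hgs : IsGroundState P E₀ Ψ₀)
    (Ω : ℝ) (hness : P.essSpec.Nonempty) (hΩ : Ω = sInf P.essSpec - E₀) (hΩpos : 0 < Ω)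
    (T : 𝓗N →L[ℂ] 𝓗')
    (χs : ℂ → (𝓗' →L[ℂ] 𝓗')) (hχs : IsSymmetrizedDDRF P E₀ Ω T χs)
    -- `ω₁` is the smallest pole of `χ̂_s` in `(0,Ω)`, or `Ω` if there is none
    (ω₁ : ℝ) (hω₁pos : 0 < ω₁)
    (hω₁mem : (ω₁ : ℂ) ∈ chisPoles P E₀ Ω T ∨ ω₁ = Ω)
    (hω₁min : ∀ x : ℝ, 0 < x → (x : ℂ) ∈ chisPoles P E₀ Ω T → ω₁ ≤ x) :
    ∃ C : ℝ, 0 < C ∧ ∀ μ₀ : ℝ, 0 < μ₀ →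
      (∀ z ∈ DOmega Ω, (z.im ≠ 0 ∨ |z.re| < ω₁) →
        IsUnit ((μ₀ : ℂ) • (1 : 𝓗' →L[ℂ] 𝓗') - χs z)) ∧
      (∀ z : ℂ, z.im ≠ 0 →
        ‖Ring.inverse ((μ₀ : ℂ) • (1 : 𝓗' →L[ℂ] 𝓗') - χs z)‖ ≤
          C * μ₀⁻¹ * ‖z‖ * |z.im|⁻¹) := by
  have hω₁Ω : ω₁ ≤ Ω := by
    rcases hω₁mem with ⟨ω, hω, -, hlt, -⟩ | h
    · obtain rfl : ω₁ = ω := Complex.ofReal_injective hω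
      exact (le_abs_self _).trans hlt.le
    · exact h.le
  have hpos : ∀ {μ₀ : ℝ} {z : ℂ}, 0 < μ₀ → z.im ≠ 0 → 0 < μ₀ * |z.im| / ‖z‖ := fun hμ hz =>
    div_pos (mul_pos hμ (abs_pos.2 hz)) (norm_pos_iff.2 fun h => hz (by simp [h]))
  refine ⟨1, one_pos, fun μ₀ hμ₀ => ⟨fun z _ hz => ?_, fun z hz => ?_⟩⟩
  · by_cases him : z.im = 0
    · have hx : |z.re| < ω₁ := hz.resolve_left (not_not.2 him)
      have hzre : z = (z.re : ℂ) := Complex.ext rfl (by simpa using him)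
      rw [hzre]
      exact isUnit_of_le_norm_inner hμ₀
        (hχs.le_norm_inner_of_real hgs hΩ hω₁Ω hω₁min μ₀ hx)
    · exact isUnit_of_le_norm_inner (hpos hμ₀ him) (hχs.le_norm_inner_of_im_ne_zero hgs μ₀ him)
  · refine (norm_ringInverse_le_of_le_norm_inner (hpos hμ₀ hz)
      (hχs.le_norm_inner_of_im_ne_zero hgs μ₀ hz)).trans_eq ?_
    rw [inv_div, div_eq_mul_inv, mul_inv]
    ring

end
end

section
/- Let 𝓗 be a Hilbert space, z₀ ∈ ℂ, ε > 0, and let K : B_ε(z₀) → B(𝓗) be a holomorphic family of bounded operators such that K(z₀) is normal, 0 is an isolated point of the spectrum of K(z₀), and M = dim ker K(z₀) < ∞. Suppose there exists C > 0 such that ‖K(z₀+iη)f‖ ≥ C|η|‖f‖ for all f ∈ 𝓗 and all sufficiently small η > 0. Then K(z) is invertible for all z ≠ z₀ sufficiently close to z₀, and on a possibly smaller ball one has K(z)^{−1} = K_{−1}/(z−z₀) + K₀(z), where K_{−1} ∈ B(𝓗) has rank exactly M and K₀ is holomorphic on that ball. -/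
open scoped InnerProductSpace
noncomputable section

lemma continuousOn_update_of_isolated {S : Set ℂ} {δ : ℝ} (hδ : 0 < δ)
    (hS : ∀ μ ∈ S, ‖μ‖ < δ → μ = 0) {h : ℂ → ℂ} (hh : ContinuousOn h {0}ᶜ) (c : ℂ) :
    ContinuousOn (Function.update h 0 c) S := by
  intro x hx
  by_cases hx0 : x = 0
  · subst hx0
    have hev : ∀ᶠ y in nhdsWithin (0 : ℂ) S, Function.update h 0 c y = c := by
      filter_upwards [self_mem_nhdsWithin,
        mem_nhdsWithin_of_mem_nhds (Metric.ball_mem_nhds (0 : ℂ) hδ)] with y hyS hy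
      rw [hS y hyS (by simpa using hy), Function.update_self]
    refine ContinuousWithinAt.congr_of_eventuallyEq
      (continuousWithinAt_const (b := c)) hev (by simp)
  · refine ContinuousAt.continuousWithinAt ?_
    rw [continuousAt_update_of_ne hx0]
    exact hh.continuousAt (isOpen_compl_singleton.mem_nhds hx0)

/-- The Riesz projection `E` of a normal element at an isolated point `0` of its spectrum,
together with an inverse `G` of `a` modulo `E`. -/
lemma IsStarNormal.exists_riesz_projection {A : Type*} [CStarAlgebra A] {a : A}
    (ha : IsStarNormal a) {δ : ℝ} (hδ : 0 < δ)
    (hS : ∀ μ ∈ spectrum ℂ a, ‖μ‖ < δ → μ = 0) :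
    ∃ E G : A, a * E = 0 ∧ E * a = 0 ∧ E * E = E ∧ a * G = 1 - E ∧ G * a = 1 - E ∧
      E * G = E := by
  set e : ℂ → ℂ := Function.update (fun _ => 0) 0 1 with he
  set g : ℂ → ℂ := Function.update (fun μ => μ⁻¹) 0 1 with hg
  have hec : ContinuousOn e (spectrum ℂ a) :=
    continuousOn_update_of_isolated hδ hS continuousOn_const 1
  have hgc : ContinuousOn g (spectrum ℂ a) :=
    continuousOn_update_of_isolated hδ hS
      (continuousOn_inv₀.mono (by intro x hx; simpa using hx)) 1
  have mul_eq {u v w : ℂ → ℂ} (hu : ContinuousOn u (spectrum ℂ a))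
      (hv : ContinuousOn v (spectrum ℂ a)) (h : ∀ x, u x * v x = w x) :
      cfc u a * cfc v a = cfc w a := by
    rw [← cfc_mul u v a hu hv]
    exact congrArg (fun f => cfc f a) (funext h)
  have hid : cfc (fun x : ℂ => x) a = a := cfc_id' ℂ a
  have h1 : cfc (fun x => 1 - e x) a = 1 - cfc e a := by
    rw [cfc_sub (fun _ => (1 : ℂ)) e a continuousOn_const hec, cfc_const_one ℂ a]
  have h0 : cfc (fun _ : ℂ => (0 : ℂ)) a = 0 := cfc_const_zero ℂ a
  have hx : ∀ x : ℂ, (x = 0 ∧ e x = 1 ∧ g x = 1) ∨ (x ≠ 0 ∧ e x = 0 ∧ g x = x⁻¹) := by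
    intro x
    by_cases hx : x = 0
    · left; subst hx; simp [he, hg]
    · right; simp [he, hg, hx]
  refine ⟨cfc e a, cfc g a, ?_, ?_, mul_eq hec hec ?_, ?_, ?_, mul_eq hec hgc ?_⟩
  · rw [← h0]
    conv_lhs => enter [1]; rw [← hid]
    exact mul_eq continuousOn_id hec fun x => by
      rcases hx x with ⟨h, h', -⟩ | ⟨h, h', -⟩ <;> simp [h, h']
  · rw [← h0]
    conv_lhs => enter [2]; rw [← hid]
    exact mul_eq hec continuousOn_id fun x => by
      rcases hx x with ⟨h, h', -⟩ | ⟨h, h', -⟩ <;> simp [h, h']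
  · intro x
    rcases hx x with ⟨h, h', -⟩ | ⟨h, h', -⟩ <;> simp [h']
  · rw [← h1]
    conv_lhs => enter [1]; rw [← hid]
    exact mul_eq continuousOn_id hgc fun x => by
      rcases hx x with ⟨h, h', h''⟩ | ⟨h, h', h''⟩ <;> rw [h', h''] <;> simp [h]
  · rw [← h1]
    conv_lhs => enter [2]; rw [← hid]
    exact mul_eq hgc continuousOn_id fun x => by
      rcases hx x with ⟨h, h', h''⟩ | ⟨h, h', h''⟩ <;> rw [h', h''] <;> simp [h]
  · intro x
    rcases hx x with ⟨h, h', h''⟩ | ⟨h, h', h''⟩ <;> simp [h', h'']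

lemma scaled_projection_mul_eq_one {𝕜 A : Type*} [CommRing 𝕜] [Ring A] [Algebra 𝕜 A] {E : A}
    (hE : E * E = E) {c d : 𝕜} (hcd : c * d = 1) :
    ((1 - E) + c • E) * ((1 - E) + d • E) = 1 := by
  have h : (c • E) * (d • E) = E := by rw [smul_mul_smul_comm, hE, hcd, one_smul]
  have h1 : (1 - E) * (d • E) = 0 := by
    rw [mul_smul_comm, sub_mul, hE, one_mul, sub_self, smul_zero]
  have h2 : (c • E) * (1 - E) = 0 := by
    rw [smul_mul_assoc, mul_sub, hE, mul_one, sub_self, smul_zero]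
  have h3 : (1 - E) * (1 - E) = 1 - E := by
    rw [mul_sub, mul_one, sub_mul, hE, one_mul, sub_self, sub_zero]
  rw [add_mul, mul_add, mul_add, h, h1, h2, h3, add_zero, zero_add, sub_add_cancel]

section Pencil

variable {𝓗 : Type*} [NormedAddCommGroup 𝓗] [NormedSpace ℂ 𝓗]

/-- If `K z = K z₀ + (z - z₀) • L z` is bounded below by `C η` at `z = z₀ + iη` and `K z₀` is
invertible modulo `E`, then `E ∘ L z₀` is injective on the kernel of `K z₀`. -/
lemma eq_zero_of_lower_bound {z₀ : ℂ} {K L : ℂ → (𝓗 →L[ℂ] 𝓗)}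
    (hKL : ∀ z, K z = K z₀ + (z - z₀) • L z) (hL : ContinuousAt L z₀)
    {E G : 𝓗 →L[ℂ] 𝓗} (hAG : K z₀ * G = 1 - E)
    {C η₀ : ℝ} (hC : 0 < C) (hη₀ : 0 < η₀)
    (hlower : ∀ η : ℝ, 0 < η → η < η₀ → ∀ f : 𝓗,
      C * η * ‖f‖ ≤ ‖K (z₀ + Complex.I * (η : ℂ)) f‖)
    {f : 𝓗} (hf : K z₀ f = 0) (hEf : E (L z₀ f) = 0) : f = 0 := by
  set g : 𝓗 := -(Complex.I • G (L z₀ f)) with hg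
  have hAg : K z₀ g = -(Complex.I • L z₀ f) := by
    have := DFunLike.congr_fun hAG (L z₀ f)
    simp only [mul_apply_eq_comp, sub_apply,
      one_apply_eq_self, hEf, sub_zero] at this
    rw [hg, map_neg, map_smul, this]
  have hz : Filter.Tendsto (fun η : ℝ => z₀ + Complex.I * (η : ℂ)) (nhdsWithin 0 (Set.Ioi 0))
      (nhds z₀) := by
    have : Continuous (fun η : ℝ => z₀ + Complex.I * (η : ℂ)) := by fun_prop
    simpa using (this.tendsto 0).mono_left nhdsWithin_le_nhds
  have hLz := hL.tendsto.comp hz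
  have hη : Filter.Tendsto (fun η : ℝ => (η : ℂ)) (nhdsWithin 0 (Set.Ioi 0)) (nhds 0) := by
    simpa using (Complex.continuous_ofReal.tendsto 0).mono_left nhdsWithin_le_nhds
  have happ : ∀ v : 𝓗, Filter.Tendsto (fun η : ℝ => L (z₀ + Complex.I * (η : ℂ)) v)
      (nhdsWithin 0 (Set.Ioi 0)) (nhds (L z₀ v)) := fun v =>
    ((ContinuousLinearMap.apply ℂ 𝓗 v).continuous.tendsto _).comp hLz
  have hleft : Filter.Tendsto (fun η : ℝ => C * ‖f + (η : ℂ) • g‖)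
      (nhdsWithin 0 (Set.Ioi 0)) (nhds (C * ‖f‖)) := by
    simpa using ((hη.smul_const g).const_add f).norm.const_mul C
  have hright : Filter.Tendsto (fun η : ℝ => ‖L (z₀ + Complex.I * (η : ℂ)) f - L z₀ f
      + (η : ℂ) • L (z₀ + Complex.I * (η : ℂ)) g‖) (nhdsWithin 0 (Set.Ioi 0)) (nhds 0) := by
    simpa using (((happ f).sub_const (L z₀ f)).add (hη.smul (happ g))).norm
  have hle : ∀ᶠ η : ℝ in nhdsWithin 0 (Set.Ioi 0), C * ‖f + (η : ℂ) • g‖ ≤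
      ‖L (z₀ + Complex.I * (η : ℂ)) f - L z₀ f
        + (η : ℂ) • L (z₀ + Complex.I * (η : ℂ)) g‖ := by
    filter_upwards [Ioo_mem_nhdsGT hη₀] with η hη
    have h := hlower η hη.1 hη.2 (f + (η : ℂ) • g)
    have hK : K (z₀ + Complex.I * (η : ℂ)) (f + (η : ℂ) • g) = (Complex.I * (η : ℂ)) •
        (L (z₀ + Complex.I * (η : ℂ)) f - L z₀ f
          + (η : ℂ) • L (z₀ + Complex.I * (η : ℂ)) g) := by
      rw [hKL]
      simp only [add_sub_cancel_left, add_apply,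
        smul_apply, map_add, map_smul, hf, hAg]
      module
    rw [hK, norm_smul, norm_mul, Complex.norm_I, one_mul, Complex.norm_real,
      Real.norm_of_nonneg hη.1.le] at h
    exact le_of_mul_le_mul_left (by linarith) hη.1
  have := le_of_tendsto_of_tendsto hleft hright hle
  have hn : ‖f‖ ≤ 0 := by
    by_contra! hpos
    nlinarith [mul_pos hC hpos]
  exact norm_le_zero_iff.mp hn

variable [CompleteSpace 𝓗]

/-- If `E` is the projection onto the finite-dimensional kernel of `A` along its range, with `A`
invertible modulo `E`, and `E * B` is injective on this kernel, then `A + B * E` is invertible. -/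
lemma isUnit_add_mul_projection {A B E G : 𝓗 →L[ℂ] 𝓗}
    (hAE : A * E = 0) (hEA : E * A = 0) (hEE : E * E = E) (hAG : A * G = 1 - E)
    (hGA : G * A = 1 - E) (hEG : E * G = E)
    (hfin : FiniteDimensional ℂ ↥(LinearMap.ker A.toLinearMap))
    (hinj : ∀ f, A f = 0 → E (B f) = 0 → f = 0) :
    IsUnit (A + B * E) := by
  have aAE : ∀ x, A (E x) = 0 := fun x => DFunLike.congr_fun hAE x
  have aEA : ∀ x, E (A x) = 0 := fun x => DFunLike.congr_fun hEA x
  have aEE : ∀ x, E (E x) = E x := fun x => DFunLike.congr_fun hEE x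
  have aAG : ∀ x, A (G x) = x - E x := fun x => DFunLike.congr_fun hAG x
  have aGA : ∀ x, G (A x) = x - E x := fun x => DFunLike.congr_fun hGA x
  have aEG : ∀ x, E (G x) = E x := fun x => DFunLike.congr_fun hEG x
  have hker : ∀ x, A x = 0 → E x = x := fun x hx => by
    have := aGA x
    rw [hx, map_zero] at this
    exact (sub_eq_zero.mp this.symm).symm
  rw [ContinuousLinearMap.isUnit_iff_bijective]
  constructor
  · rw [injective_iff_map_eq_zero]
    intro x hx
    simp only [add_apply, mul_apply_eq_comp] at hx
    have hE := congrArg E hx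
    rw [map_add, aEA, zero_add, map_zero] at hE
    have hEx := hinj (E x) (aAE x) hE
    rw [hEx, map_zero, add_zero] at hx
    rw [← hker x hx, hEx]
  · intro y
    let R : ↥(LinearMap.ker A.toLinearMap) →ₗ[ℂ] ↥(LinearMap.ker A.toLinearMap) :=
      LinearMap.codRestrict _ ((E * B).toLinearMap ∘ₗ Submodule.subtype _) fun x => aAE (B x)
    have hR : Function.Injective R := by
      rw [injective_iff_map_eq_zero]
      intro x hx
      exact Subtype.ext (hinj x x.2 (congrArg Subtype.val hx))
    obtain ⟨f, hf⟩ := LinearMap.surjective_of_injective hR ⟨E y, aAE y⟩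
    have hf' : E (B f) = E y := congrArg Subtype.val hf
    have hAf : A (f : 𝓗) = 0 := f.2
    refine ⟨f + G (y - B f), ?_⟩
    simp only [add_apply, mul_apply_eq_comp, map_add, hAf, aAG,
      aEG, hker _ hAf, map_sub, hf']
    abel

end Pencil

theorem simple_pole_of_normal_operator_family
    {𝓗 : Type*} [NormedAddCommGroup 𝓗] [InnerProductSpace ℂ 𝓗] [CompleteSpace 𝓗]
    (z₀ : ℂ) (ε : ℝ) (hε : 0 < ε)
    -- a holomorphic family of bounded operators on `B_ε(z₀)`
    (K : ℂ → (𝓗 →L[ℂ] 𝓗)) (hK : AnalyticOnNhd ℂ K (Metric.ball z₀ ε))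
    -- `K(z₀)` is normal
    (hnormal : IsStarNormal (K z₀))
    -- `0` is an isolated point of the spectrum of `K(z₀)`
    (h0mem : (0 : ℂ) ∈ spectrum ℂ (K z₀))
    (h0isolated : ∃ δ > 0, ∀ μ ∈ spectrum ℂ (K z₀), ‖μ‖ < δ → μ = 0)
    -- `M = dim ker K(z₀) < ∞`
    (hfinker : FiniteDimensional ℂ ↥(LinearMap.ker (K z₀).toLinearMap))
    -- the lower bound `‖K(z₀+iη)f‖ ≥ C|η|‖f‖` for small `η > 0`
    (hlower : ∃ C > 0, ∃ η₀ > 0, ∀ η : ℝ, 0 < η → η < η₀ → ∀ f : 𝓗,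
      C * η * ‖f‖ ≤ ‖K (z₀ + Complex.I * (η : ℂ)) f‖) :
    ∃ δ > 0, δ ≤ ε ∧ ∃ (Km1 : 𝓗 →L[ℂ] 𝓗) (K0 : ℂ → (𝓗 →L[ℂ] 𝓗)),
      FiniteDimensional ℂ ↥(LinearMap.range Km1.toLinearMap) ∧
      Module.finrank ℂ ↥(LinearMap.range Km1.toLinearMap) =
        Module.finrank ℂ ↥(LinearMap.ker (K z₀).toLinearMap) ∧
      AnalyticOnNhd ℂ K0 (Metric.ball z₀ δ) ∧
      ∀ z ∈ Metric.ball z₀ δ, z ≠ z₀ →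
        IsUnit (K z) ∧ Ring.inverse (K z) = (z - z₀)⁻¹ • Km1 + K0 z := by
  obtain ⟨r, hr, hiso⟩ := h0isolated
  obtain ⟨C, hC, η₀, hη₀, hlow⟩ := hlower
  obtain ⟨E, G, hAE, hEA, hEE, hAG, hGA, hEG⟩ := hnormal.exists_riesz_projection hr hiso
  set L := dslope K z₀ with hLdef
  have hKL : ∀ z, K z = K z₀ + (z - z₀) • L z := fun z => by
    rw [hLdef, sub_smul_dslope, add_sub_cancel]
  have hL : DifferentiableOn ℂ L (Metric.ball z₀ ε) :=
    (Complex.differentiableOn_dslope (Metric.ball_mem_nhds z₀ hε)).mpr hK.differentiableOn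
  have hLc : ContinuousAt L z₀ :=
    (hL.differentiableAt (Metric.ball_mem_nhds z₀ hε)).continuousAt
  let T : ℂ → (𝓗 →L[ℂ] 𝓗) := fun z => K z₀ + (z - z₀) • (L z * (1 - E)) + L z * E
  have hT : DifferentiableOn ℂ T (Metric.ball z₀ ε) := by
    fun_prop
  have hT₀ : IsUnit (T z₀) := by
    have := isUnit_add_mul_projection (B := L z₀) hAE hEA hEE hAG hGA hEG hfinker fun f hf hEf =>
      eq_zero_of_lower_bound hKL hLc hAG hC hη₀ hlow hf hEf
    simpa [T] using this
  have hev : ∀ᶠ z in nhds z₀, IsUnit (T z) :=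
    (hT.differentiableAt (Metric.ball_mem_nhds z₀ hε)).continuousAt.eventually
      (Units.isOpen.mem_nhds hT₀)
  obtain ⟨δ₁, hδ₁, hball⟩ := Metric.eventually_nhds_iff_ball.mp hev
  have hsub : Metric.ball z₀ (min δ₁ ε) ⊆ Metric.ball z₀ ε :=
    Metric.ball_subset_ball (min_le_right _ _)
  have hδ : 0 < min δ₁ ε := lt_min hδ₁ hε
  have hunit : ∀ z ∈ Metric.ball z₀ (min δ₁ ε), IsUnit (T z) := fun z hz =>
    hball z (Metric.ball_subset_ball (min_le_left _ _) hz)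
  let V : ℂ → (𝓗 →L[ℂ] 𝓗) := fun z => Ring.inverse (T z)
  have hV : DifferentiableOn ℂ V (Metric.ball z₀ (min δ₁ ε)) := fun z hz => by
    obtain ⟨u, hu⟩ := hunit z hz
    have h1 : DifferentiableAt ℂ Ring.inverse (T z) := by
      rw [← hu]; exact differentiableAt_inverse u.isUnit
    exact h1.comp_differentiableWithinAt z (hT.mono hsub z hz)
  have hdV : DifferentiableOn ℂ (dslope V z₀) (Metric.ball z₀ (min δ₁ ε)) :=
    (Complex.differentiableOn_dslope (Metric.ball_mem_nhds z₀ hδ)).mpr hV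
  have hrange : LinearMap.range (E * V z₀).toLinearMap = LinearMap.ker (K z₀).toLinearMap := by
    ext x
    simp only [LinearMap.mem_range, LinearMap.mem_ker]
    constructor
    · rintro ⟨y, rfl⟩
      exact DFunLike.congr_fun hAE (V z₀ y)
    · intro hx
      refine ⟨T z₀ x, ?_⟩
      have h1 : V z₀ (T z₀ x) = x :=
        DFunLike.congr_fun (Ring.inverse_mul_cancel _ hT₀) x
      have h2 : G (K z₀ x) = x - E x := DFunLike.congr_fun hGA x
      have h3 : K z₀ x = 0 := hx
      rw [h3, map_zero] at h2
      change E (V z₀ (T z₀ x)) = x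
      rw [h1]
      exact (sub_eq_zero.mp h2.symm).symm
  refine ⟨min δ₁ ε, hδ, min_le_right _ _, E * V z₀,
    fun z => (1 - E) * V z + E * dslope V z₀ z, ?_, ?_, ?_, ?_⟩
  · rw [hrange]; exact hfinker
  · rw [hrange]
  · refine DifferentiableOn.analyticOnNhd ?_ Metric.isOpen_ball
    fun_prop
  · intro z hz hne
    have hw : z - z₀ ≠ 0 := sub_ne_zero.mpr hne
    have hTz := hunit z hz
    have hF : ((1 - E) + (z - z₀) • E) * ((1 - E) + (z - z₀)⁻¹ • E) = 1 :=
      scaled_projection_mul_eq_one hEE (mul_inv_cancel₀ hw)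
    have hF' : ((1 - E) + (z - z₀)⁻¹ • E) * ((1 - E) + (z - z₀) • E) = 1 :=
      scaled_projection_mul_eq_one hEE (inv_mul_cancel₀ hw)
    have hKT : K z = T z * ((1 - E) + (z - z₀) • E) := by
      rw [hKL z]
      simp only [T, add_mul, mul_add, sub_mul, mul_sub, smul_mul_assoc, mul_smul_comm, hEE,
        mul_one, mul_assoc, hAE, sub_self, smul_sub]
      abel_nf
    have h1 : K z * (((1 - E) + (z - z₀)⁻¹ • E) * V z) = 1 := by
      rw [hKT, mul_assoc, ← mul_assoc _ _ (V z), hF, one_mul]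
      exact Ring.mul_inverse_cancel _ hTz
    have h2 : (((1 - E) + (z - z₀)⁻¹ • E) * V z) * K z = 1 := by
      rw [hKT, mul_assoc, ← mul_assoc (V z), Ring.inverse_mul_cancel _ hTz, one_mul, hF']
    refine ⟨⟨⟨_, _, h1, h2⟩, rfl⟩, ?_⟩
    have hinv : Ring.inverse (K z) = ((1 - E) + (z - z₀)⁻¹ • E) * V z :=
      Ring.inverse_unit (⟨_, _, h1, h2⟩ : (𝓗 →L[ℂ] 𝓗)ˣ)
    have hVz : V z = V z₀ + (z - z₀) • dslope V z₀ z := by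
      rw [sub_smul_dslope, add_sub_cancel]
    rw [hinv, add_mul, smul_mul_assoc]
    conv_lhs => enter [2]; rw [hVz]
    rw [mul_add, mul_smul_comm, smul_add, smul_smul, inv_mul_cancel₀ hw, one_smul]
    exact add_left_comm _ _ _

end
end

section
/- Let 𝓗 be a Hilbert space, V ⊆ 𝓗 a closed subspace with orthogonal projection P_V, and let B ∈ B(𝓗) be invertible with respect to P_V (i.e. P_V B P_V = B and there exists B^{−1} ∈ B(𝓗) with P_V B^{−1} P_V = B^{−1} and B^{−1}B = BB^{−1} = P_V). Let z ↦ A(z) ∈ B(𝓗) be an analytic family of operators defined near 0 such that P_V^⊥ A(z) P_V^⊥ is invertible with respect to P_V^⊥ = 1 − P_V, with a bound on the inverse uniform in z. Then for all z ∈ ℂ \ {0} of sufficiently small modulus, the operator A(z) + z^{−1}B is invertible in B(𝓗), and (A(z) + z^{−1}B)^{−1} = (P_V^⊥ A(z) P_V^⊥)^{−1} + O(|z|), where (P_V^⊥ A(z) P_V^⊥)^{−1} denotes the inverse with respect to P_V^⊥ and the O(|z|) is in operator norm. -/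
/-!
STATEMENT 19 (Lemma 4.7, inverse of an operator-valued function around a pole): if `B` is
invertible with respect to the orthogonal projection `P_V` onto a closed subspace `V`,
`A(z)` is an analytic family near `0`, and `P_V^⊥ A(z) P_V^⊥` is invertible with respect to
`P_V^⊥` with a uniform bound on the inverse, then for small `z ≠ 0` the operator
`A(z) + z⁻¹B` is invertible, with `(A(z) + z⁻¹B)⁻¹ = (P_V^⊥ A(z) P_V^⊥)⁻¹ + O(|z|)`.
-/

open scoped InnerProductSpace
noncomputable section

/-- `B` is invertible with respect to the projection `P`, with inverse `Binv`:
`PBP = B`, `PBinvP = Binv` and `Binv B = B Binv = P`. -/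
def InvertibleWrt {𝓗 : Type*} [NormedAddCommGroup 𝓗] [InnerProductSpace ℂ 𝓗]
    (P B Binv : 𝓗 →L[ℂ] 𝓗) : Prop :=
  P ∘L B ∘L P = B ∧ P ∘L Binv ∘L P = Binv ∧ Binv ∘L B = P ∧ B ∘L Binv = P

/-- The orthogonal projection onto a closed subspace `V`, as an endomorphism. -/
noncomputable def projCl {𝓗 : Type*} [NormedAddCommGroup 𝓗] [InnerProductSpace ℂ 𝓗]
    [CompleteSpace 𝓗] (V : Submodule ℂ 𝓗) (hV : IsClosed (V : Set 𝓗)) : 𝓗 →L[ℂ] 𝓗 :=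
  haveI : CompleteSpace ↥V := hV.completeSpace_coe
  haveI : Submodule.HasOrthogonalProjection V := Submodule.HasOrthogonalProjection.ofCompleteSpace (K := V)
  V.subtypeL ∘L Submodule.orthogonalProjectionOnto V

section NormedAlgebra

variable {R : Type*} [NormedRing R]

theorem isUnit_one_add_of_norm_le_half [CompleteSpace R] {x : R} (hx : ‖x‖ ≤ 1 / 2) :
    IsUnit (1 + x) := by
  have h := isUnit_one_sub_of_norm_lt_one (x := -x) (by rw [norm_neg]; linarith)
  rwa [sub_neg_eq_add] at h

theorem isUnit_of_isUnit_mul_of_isUnit_mul {M : Type*} [Monoid M] {a b c : M}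
    (hb : IsUnit (a * b)) (hc : IsUnit (c * a)) : IsUnit a := by
  obtain ⟨u, hu⟩ := hb
  obtain ⟨v, hv⟩ := hc
  refine isUnit_iff_exists_and_exists.2 ⟨⟨b * ↑u⁻¹, ?_⟩, ⟨↑v⁻¹ * c, ?_⟩⟩
  · rw [← mul_assoc, ← hu, Units.mul_inv]
  · rw [mul_assoc, ← hv, Units.inv_mul]

theorem norm_inverse_le_of_mul_eq_one_add {T S x : R} (hT : IsUnit T) (h : T * S = 1 + x)
    (hx : ‖x‖ ≤ 1 / 2) : ‖Ring.inverse T‖ ≤ 2 * ‖S‖ := by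
  have h₁ : Ring.inverse T = S - Ring.inverse T * x := by
    have : S = Ring.inverse T * (1 + x) := by
      rw [← h, Ring.inverse_mul_cancel_left _ _ hT]
    rw [mul_add, mul_one] at this
    exact eq_sub_of_add_eq this.symm
  have h₂ : ‖Ring.inverse T‖ ≤ ‖S‖ + ‖Ring.inverse T‖ * ‖x‖ := by
    calc ‖Ring.inverse T‖ = ‖S - Ring.inverse T * x‖ := congrArg _ h₁
      _ ≤ ‖S‖ + ‖Ring.inverse T * x‖ := norm_sub_le _ _
      _ ≤ _ := by gcongr; exact norm_mul_le _ _
  nlinarith [norm_nonneg (Ring.inverse T)]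

variable [NormedAlgebra ℂ R]

/-- The right parametrix of a block operator with a simple pole. -/
theorem mul_right_parametrix {P A B Bi Ai : R} {z : ℂ} (hz : z ≠ 0) (hP : P * P = P)
    (hBP : B * P = B) (hBBi : B * Bi = P) (hPAi : P * Ai = 0)
    (hA : A * Ai - P * A * Ai = 1 - P) :
    (A + z⁻¹ • B) * (Ai + z • (Bi * (1 - P * A * Ai))) =
      1 + z • (A * (Bi * (1 - P * A * Ai))) := by
  have hBAi : B * Ai = 0 := by rw [← hBP, mul_assoc, hPAi, mul_zero]
  have h : B * (Bi * (1 - P * A * Ai)) = P - P * A * Ai := by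
    rw [← mul_assoc, hBBi, mul_sub, mul_one, ← mul_assoc, ← mul_assoc, hP]
  rw [add_mul, mul_add, mul_add, smul_mul_assoc, smul_mul_assoc, hBAi, mul_smul_comm,
    mul_smul_comm, smul_smul, inv_mul_cancel₀ hz, one_smul, h, smul_zero, zero_add]
  rw [← sub_eq_zero] at hA ⊢
  rw [← hA]
  abel

/-- The left parametrix of a block operator with a simple pole. -/
theorem left_parametrix_mul {P A B Bi Ai : R} {z : ℂ} (hz : z ≠ 0) (hP : P * P = P)
    (hPB : P * B = B) (hBiB : Bi * B = P) (hAiP : Ai * P = 0)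
    (hA : Ai * A - Ai * A * P = 1 - P) :
    (Ai + z • ((1 - Ai * A * P) * Bi)) * (A + z⁻¹ • B) =
      1 + z • ((1 - Ai * A * P) * Bi * A) := by
  have hAiB : Ai * B = 0 := by rw [← hPB, ← mul_assoc, hAiP, zero_mul]
  have h : (1 - Ai * A * P) * Bi * B = P - Ai * A * P := by
    rw [mul_assoc, hBiB, sub_mul, one_mul, mul_assoc _ P P, hP]
  rw [mul_add, add_mul, add_mul, mul_smul_comm, mul_smul_comm, hAiB, smul_mul_assoc,
    smul_mul_assoc, smul_smul, inv_mul_cancel₀ hz, one_smul, h, smul_zero, zero_add]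
  rw [← sub_eq_zero] at hA ⊢
  rw [← hA]
  abel

/-- Quantitative inversion of `A + z⁻¹ B`, where `n` and `e` bound the corrections
in the parametrices. -/
theorem isUnit_add_inv_smul_and_norm_inverse_sub_le [CompleteSpace R] {P A B Bi Ai : R} {z : ℂ}
    {K M : ℝ} (hz : z ≠ 0) (hP : P * P = P) (hPB : P * B = B) (hBP : B * P = B)
    (hBiB : Bi * B = P) (hBBi : B * Bi = P) (hPAi : P * Ai = 0) (hAiP : Ai * P = 0)
    (hAAi : A * Ai - P * A * Ai = 1 - P) (hAiA : Ai * A - Ai * A * P = 1 - P)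
    (hK : ‖A‖ ≤ K) (hM : ‖Ai‖ ≤ M) {n e : ℝ} (hn : n = ‖(1 : R)‖ + ‖P‖ * K * M)
    (he : e = K * (‖Bi‖ * n)) (hz₁ : ‖z‖ ≤ 1) (hze : ‖z‖ * e ≤ 1 / 2) :
    IsUnit (A + z⁻¹ • B) ∧
      ‖Ring.inverse (A + z⁻¹ • B) - Ai‖ ≤ (‖Bi‖ * n + 2 * (M + ‖Bi‖ * n) * e) * ‖z‖ := by
  have hK₀ : 0 ≤ K := (norm_nonneg _).trans hK
  have hM₀ : 0 ≤ M := (norm_nonneg _).trans hM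
  have hn₀ : 0 ≤ n := by rw [hn]; positivity
  have he₀ : 0 ≤ e := by rw [he]; positivity
  have hr : ‖Bi * (1 - P * A * Ai)‖ ≤ ‖Bi‖ * n := by
    refine (norm_mul_le _ _).trans ?_
    gcongr
    rw [hn]
    refine (norm_sub_le _ _).trans ?_
    gcongr
    refine norm_mul₃_le.trans ?_
    gcongr
  have hl : ‖(1 - Ai * A * P) * Bi‖ ≤ ‖Bi‖ * n := by
    rw [mul_comm ‖Bi‖]
    refine (norm_mul_le _ _).trans ?_
    gcongr
    rw [hn]
    refine (norm_sub_le _ _).trans ?_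
    gcongr
    refine norm_mul₃_le.trans ?_
    calc ‖Ai‖ * ‖A‖ * ‖P‖ ≤ M * K * ‖P‖ := by gcongr
      _ = _ := by ring
  have hr' : ‖A * (Bi * (1 - P * A * Ai))‖ ≤ e := by
    rw [he]
    refine (norm_mul_le _ _).trans ?_
    gcongr
  have hl' : ‖(1 - Ai * A * P) * Bi * A‖ ≤ e := by
    rw [he, mul_comm K]
    refine (norm_mul_le _ _).trans ?_
    gcongr
  have hR := mul_right_parametrix hz hP hBP hBBi hPAi hAAi
  have hL := left_parametrix_mul hz hP hPB hBiB hAiP hAiA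
  set F := Bi * (1 - P * A * Ai)
  have hsr : ‖z • (A * F)‖ ≤ 1 / 2 := by
    rw [norm_smul]; exact (by gcongr : _ ≤ ‖z‖ * e).trans hze
  have hsl : ‖z • ((1 - Ai * A * P) * Bi * A)‖ ≤ 1 / 2 := by
    rw [norm_smul]; exact (by gcongr : _ ≤ ‖z‖ * e).trans hze
  have hT : IsUnit (A + z⁻¹ • B) :=
    isUnit_of_isUnit_mul_of_isUnit_mul (hR ▸ isUnit_one_add_of_norm_le_half hsr)
      (hL ▸ isUnit_one_add_of_norm_le_half hsl)
  refine ⟨hT, ?_⟩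
  have hinv := norm_inverse_le_of_mul_eq_one_add hT hR hsr
  have hS : ‖Ai + z • F‖ ≤ M + ‖Bi‖ * n := by
    refine (norm_add_le _ _).trans ?_
    rw [norm_smul]
    nlinarith [norm_nonneg F]
  set T := A + z⁻¹ • B
  have hdiff : Ring.inverse T - Ai = z • (F - Ring.inverse T * (A * F)) := by
    have h : Ai + z • F = Ring.inverse T * (1 + z • (A * F)) := by
      rw [← hR, Ring.inverse_mul_cancel_left _ _ hT]
    rw [mul_add, mul_one, mul_smul_comm] at h
    rw [smul_sub, sub_eq_sub_iff_add_eq_add, ← h, add_comm]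
  rw [hdiff, norm_smul, mul_comm]
  gcongr
  refine (norm_sub_le _ _).trans (add_le_add hr ((norm_mul_le _ _).trans ?_))
  gcongr
  linarith

end NormedAlgebra

section InvertibleWrt

variable {𝓗 : Type*} [NormedAddCommGroup 𝓗] [InnerProductSpace ℂ 𝓗] {P B C C' : 𝓗 →L[ℂ] 𝓗}

theorem InvertibleWrt.mul_left (h : InvertibleWrt P B C) (hP : P * P = P) : P * B = B := by
  have h₁ : P * (B * P) = B := h.1
  rw [← h₁, ← mul_assoc, hP]

theorem InvertibleWrt.mul_right (h : InvertibleWrt P B C) (hP : P * P = P) : B * P = B := by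
  have h₁ : P * (B * P) = B := h.1
  rw [← h₁, mul_assoc, mul_assoc, hP]

theorem InvertibleWrt.symm (h : InvertibleWrt P B C) : InvertibleWrt P C B :=
  ⟨h.2.1, h.1, h.2.2.2, h.2.2.1⟩

theorem InvertibleWrt.unique (hP : P * P = P) (h : InvertibleWrt P B C)
    (h' : InvertibleWrt P B C') : C = C' := by
  have h₁ : C * B = P := h.2.2.1
  have h₂ : B * C' = P := h'.2.2.2
  rw [← h.symm.mul_right hP, ← h₂, ← mul_assoc, h₁, h'.symm.mul_left hP]

theorem projCl_mul_self [CompleteSpace 𝓗] (V : Submodule ℂ 𝓗) (hV : IsClosed (V : Set 𝓗)) :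
    projCl V hV * projCl V hV = projCl V hV := by
  have : CompleteSpace ↥V := hV.completeSpace_coe
  exact V.isIdempotentElem_starProjection

end InvertibleWrt

theorem inverse_of_operator_family_around_pole
    {𝓗 : Type*} [NormedAddCommGroup 𝓗] [InnerProductSpace ℂ 𝓗] [CompleteSpace 𝓗]
    -- a closed subspace `V`, with orthogonal projection `P_V`
    (V : Submodule ℂ 𝓗) (hV : IsClosed (V : Set 𝓗))
    -- `B` is invertible with respect to `P_V`
    (B Binv : 𝓗 →L[ℂ] 𝓗) (hB : InvertibleWrt (projCl V hV) B Binv)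
    -- `A` is an analytic family of operators near `0`
    (A : ℂ → (𝓗 →L[ℂ] 𝓗)) (hA : AnalyticAt ℂ A 0)
    -- `P_V^⊥ A(z) P_V^⊥` is invertible w.r.t. `P_V^⊥ = 1 − P_V`, with a uniform bound
    (M δ₀ : ℝ) (hδ₀ : 0 < δ₀)
    (hAinv : ∀ z : ℂ, ‖z‖ < δ₀ → ∃ Ainv : 𝓗 →L[ℂ] 𝓗,
      InvertibleWrt (1 - projCl V hV)
        ((1 - projCl V hV) ∘L A z ∘L (1 - projCl V hV)) Ainv ∧ ‖Ainv‖ ≤ M) :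
    ∃ δ > 0, ∃ C : ℝ, ∀ z : ℂ, z ≠ 0 → ‖z‖ < δ →
      IsUnit (A z + z⁻¹ • B) ∧
      ∀ Ainv : 𝓗 →L[ℂ] 𝓗,
        InvertibleWrt (1 - projCl V hV)
          ((1 - projCl V hV) ∘L A z ∘L (1 - projCl V hV)) Ainv →
        ‖Ring.inverse (A z + z⁻¹ • B) - Ainv‖ ≤ C * ‖z‖ := by
  have hP := projCl_mul_self V hV
  set P := projCl V hV
  have hQ : (1 - P) * (1 - P) = 1 - P := by rw [mul_sub, mul_one, sub_mul, one_mul, hP]; simp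
  obtain ⟨δ₁, hδ₁, hK⟩ : ∃ δ₁ > 0, ∀ z : ℂ, ‖z‖ < δ₁ → ‖A z‖ ≤ ‖A 0‖ + 1 := by
    obtain ⟨δ₁, hδ₁, h⟩ := Metric.continuousAt_iff.1 hA.continuousAt 1 one_pos
    refine ⟨δ₁, hδ₁, fun z hz => ?_⟩
    have h₁ := h (x := z) (by simpa using hz)
    rw [dist_eq_norm] at h₁
    linarith [norm_le_norm_add_norm_sub' (A z) (A 0)]
  have hM₀ : 0 ≤ M := by
    obtain ⟨Ai, -, h⟩ := hAinv 0 (by simpa using hδ₀)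
    exact (norm_nonneg _).trans h
  obtain ⟨n, hn⟩ : ∃ n, n = ‖(1 : 𝓗 →L[ℂ] 𝓗)‖ + ‖P‖ * (‖A 0‖ + 1) * M := ⟨_, rfl⟩
  obtain ⟨e, he⟩ : ∃ e, e = (‖A 0‖ + 1) * (‖Binv‖ * n) := ⟨_, rfl⟩
  have he₀ : 0 ≤ e := by rw [he, hn]; positivity
  refine ⟨min (min δ₀ δ₁) (min 1 (1 / (2 * (e + 1)))), by positivity,
    ‖Binv‖ * n + 2 * (M + ‖Binv‖ * n) * e, fun z hz hzδ => ?_⟩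
  simp only [lt_min_iff] at hzδ
  obtain ⟨⟨hz₀, hz₁⟩, hz₂, hz₃⟩ := hzδ
  obtain ⟨Ai, hAi, hAiM⟩ := hAinv z hz₀
  have hPAi : P * Ai = 0 := by
    simpa [sub_mul] using hAi.symm.mul_left hQ
  have hAiP : Ai * P = 0 := by
    simpa [mul_sub] using hAi.symm.mul_right hQ
  have hAAi : A z * Ai - P * A z * Ai = 1 - P := by
    have h : (1 - P) * (A z * (1 - P)) * Ai = 1 - P := hAi.2.2.2
    rw [mul_assoc, mul_assoc, hAi.symm.mul_left hQ] at h
    rw [← h, sub_mul, one_mul, mul_assoc]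
  have hAiA : Ai * A z - Ai * A z * P = 1 - P := by
    have h : Ai * ((1 - P) * (A z * (1 - P))) = 1 - P := hAi.2.2.1
    rw [← mul_assoc, hAi.symm.mul_right hQ] at h
    rw [← h, mul_sub, mul_sub, mul_one, mul_assoc]
  have hze : ‖z‖ * e ≤ 1 / 2 := by
    rw [lt_div_iff₀ (by positivity)] at hz₃
    nlinarith [norm_nonneg z]
  have key := isUnit_add_inv_smul_and_norm_inverse_sub_le hz hP (hB.mul_left hP)
    (hB.mul_right hP) hB.2.2.1 hB.2.2.2 hPAi hAiP hAAi hAiA (hK z hz₁) hAiM hn he hz₂.le hze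
  refine ⟨key.1, fun Ai' hAi' => ?_⟩
  rw [hAi'.unique hQ hAi]
  exact key.2

end
end
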